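/- Let u be an infinite word over a finite alphabet A with k = #A letters, whose language is closed under reversal and whose factor complexity satisfies C(n) = (k−1)n + 1 for all n ∈ ℕ. Then every palindromic factor of u has exactly one palindromic extension (Property PE) if and only if every bispecial factor of u is ordinary (Property BO). -/

import Mathlib

open List

/-- The factor of `u` of length `n` starting at position `i`. -/
def word {A : Type*} (u : ℕ → A) (i n : ℕ) : List A :=
  (List.range n).map (fun j => u (i + j))

/-- `w` occurs in `u` at position `i`. -/
def OccursAt {A : Type*} (u : ℕ → A) (w : List A) (i : ℕ) : Prop :=
  w = word u i w.length

/-- `w` is a factor of the infinite word `u`. -/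
def IsFactor {A : Type*} (u : ℕ → A) (w : List A) : Prop :=
  ∃ i, OccursAt u w i

/-- Every letter of the alphabet occurs in `u`. -/
def AllLettersOccur {A : Type*} (u : ℕ → A) : Prop :=
  ∀ a : A, ∃ i, u i = a

/-- The language of `u` is closed under reversal. -/
def ClosedUnderReversal {A : Type*} (u : ℕ → A) : Prop :=
  ∀ w : List A, IsFactor u w → IsFactor u w.reverse

/-- `u` is uniformly recurrent: every factor occurs in every window of some
bounded length. -/
def UniformlyRecurrent {A : Type*} (u : ℕ → A) : Prop :=
  ∀ w : List A, IsFactor u w → ∃ N : ℕ, ∀ i : ℕ, ∃ j : ℕ,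
    i ≤ j ∧ j < i + N ∧ OccursAt u w j

/-- Factor complexity: the number of factors of `u` of length `n`. -/
noncomputable def complexity {A : Type*} (u : ℕ → A) (n : ℕ) : ℕ :=
  Set.ncard {w : List A | w.length = n ∧ IsFactor u w}

/-- Palindromic complexity: the number of palindromic factors of `u` of
length `n`. -/
noncomputable def palComplexity {A : Type*} (u : ℕ → A) (n : ℕ) : ℕ :=
  Set.ncard {w : List A | w.length = n ∧ IsFactor u w ∧ w.reverse = w}

/-- The number of distinct palindromic factors of a finite word
(the empty word included). -/
noncomputable def palCount {A : Type*} (w : List A) : ℕ :=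
  Set.ncard {v : List A | v <:+: w ∧ v.reverse = v}

/-- `u` is rich in palindromes. -/
def Rich {A : Type*} (u : ℕ → A) : Prop :=
  ∀ w : List A, IsFactor u w → palCount w = w.length + 1

/-- `j < k` are two successive occurrences of `w` in `u`. -/
def SuccOccurrences {A : Type*} (u : ℕ → A) (w : List A) (j k : ℕ) : Prop :=
  OccursAt u w j ∧ OccursAt u w k ∧ j < k ∧
    ∀ l : ℕ, j < l → l < k → ¬ OccursAt u w l

/-- The set of return words of the factor `w` in `u`. -/
def returnWords {A : Type*} (u : ℕ → A) (w : List A) : Set (List A) :=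
  {v | ∃ j k : ℕ, SuccOccurrences u w j k ∧ v = word u j (k - j)}

/-- Left extensions of `w` in `u`. -/
def Lext {A : Type*} (u : ℕ → A) (w : List A) : Set A :=
  {a | IsFactor u (a :: w)}

/-- Right extensions of `w` in `u`. -/
def Rext {A : Type*} (u : ℕ → A) (w : List A) : Set A :=
  {b | IsFactor u (w ++ [b])}

/-- Bilateral extensions of `w` in `u`. -/
def Bext {A : Type*} (u : ℕ → A) (w : List A) : Set (A × A) :=
  {p | IsFactor u (p.1 :: (w ++ [p.2]))}

/-- Palindromic extensions of a (palindromic) factor `w` of `u`. -/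
def Pext {A : Type*} (u : ℕ → A) (w : List A) : Set (List A) :=
  {v | ∃ a : A, v = a :: (w ++ [a]) ∧ IsFactor u v}

/-- `w` is a bispecial factor of `u`. -/
def Bispecial {A : Type*} (u : ℕ → A) (w : List A) : Prop :=
  IsFactor u w ∧ 2 ≤ Set.ncard (Lext u w) ∧ 2 ≤ Set.ncard (Rext u w)

/-- The bilateral order of a factor `w` of `u`. -/
noncomputable def bilateralOrder {A : Type*} (u : ℕ → A) (w : List A) : ℤ :=
  (Set.ncard (Bext u w) : ℤ) - Set.ncard (Rext u w) - Set.ncard (Lext u w) + 1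

/-- `u` is eventually periodic. -/
def EventuallyPeriodic {A : Type*} (u : ℕ → A) : Prop :=
  ∃ p : ℕ, 0 < p ∧ ∃ N : ℕ, ∀ n : ℕ, N ≤ n → u (n + p) = u n

/-- `u` is aperiodic. -/
def Aperiodic {A : Type*} (u : ℕ → A) : Prop :=
  ¬ EventuallyPeriodic u

/-- `u` is (1-)balanced. -/
def IsBalanced {A : Type*} [DecidableEq A] (u : ℕ → A) : Prop :=
  ∀ a : A, ∀ w v : List A, IsFactor u w → IsFactor u v → w.length = v.length →
    |(w.count a : ℤ) - (v.count a : ℤ)| ≤ 1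

open Classical in
lemma inv_count {T Q : Type*} (S : Set T) (hS : S.Finite) (r : T → T) (q : T → Q)
    (hr : ∀ x, r (r x) = x) (hrS : ∀ x ∈ S, r x ∈ S)
    (hq : ∀ x y, q x = q y ↔ x = y ∨ x = r y) :
    2 * (q '' {x ∈ S | r x ≠ x}).ncard + {x ∈ S | r x = x}.ncard = S.ncard := by
  obtain ⟨F, rfl⟩ : ∃ F : Finset T, S = ↑F := ⟨hS.toFinset, by simp⟩
  have h1 : ({x ∈ (F : Set T) | r x ≠ x}) = ↑(F.filter (fun x => r x ≠ x)) := by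
    ext; simp
  have h2 : ({x ∈ (F : Set T) | r x = x}) = ↑(F.filter (fun x => r x = x)) := by
    ext; simp
  rw [h1, h2, ← Finset.coe_image, Set.ncard_coe_finset, Set.ncard_coe_finset,
    Set.ncard_coe_finset]
  have h3 := Finset.card_filter_add_card_filter_not (s := F) (fun x => r x = x)
  have h4 := Finset.card_eq_sum_card_image q (F.filter (fun x => r x ≠ x))
  have h5 : ∀ b ∈ (F.filter (fun x => r x ≠ x)).image q,
      ((F.filter (fun x => r x ≠ x)).filter (fun a => q a = b)).card = 2 := by
    intro b hb
    obtain ⟨x, hx, rfl⟩ := Finset.mem_image.1 hb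
    rw [Finset.mem_filter] at hx
    have : ((F.filter (fun x => r x ≠ x)).filter (fun a => q a = q x)) = {x, r x} := by
      ext y
      simp only [Finset.mem_filter, hq, Finset.mem_insert, Finset.mem_singleton]
      constructor
      · rintro ⟨_, h⟩; exact h
      · rintro (rfl | rfl)
        · exact ⟨hx, Or.inl rfl⟩
        · refine ⟨⟨hrS _ hx.1, ?_⟩, Or.inr rfl⟩
          rw [hr]; exact fun h => hx.2 h.symm
    rw [this, Finset.card_pair (fun h => hx.2 h.symm)]
  rw [Finset.sum_congr rfl h5, Finset.sum_const, smul_eq_mul] at h4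
  simp only [ne_eq] at *
  omega

lemma inv_count' {T Q : Type*} (S : Set T) (hS : S.Finite) (r : T → T) (q : T → Q)
    (hr : ∀ x, r (r x) = x) (hrS : ∀ x ∈ S, r x ∈ S)
    (hq : ∀ x y, q x = q y ↔ x = y ∨ x = r y) :
    2 * (q '' S).ncard = S.ncard + {x ∈ S | r x = x}.ncard := by
  have h := inv_count S hS r q hr hrS hq
  have h1 : q '' S = q '' {x ∈ S | r x ≠ x} ∪ q '' {x ∈ S | r x = x} := by
    rw [← Set.image_union]
    congr 1
    ext x
    simp only [Set.mem_union, Set.mem_setOf_eq]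
    tauto
  have h2 : Disjoint (q '' {x ∈ S | r x ≠ x}) (q '' {x ∈ S | r x = x}) := by
    rw [Set.disjoint_left]
    rintro _ ⟨x, hx, rfl⟩ ⟨y, hy, hxy⟩
    rcases (hq _ _).1 hxy with h | h
    · subst h; exact hx.2 hy.2
    · have : r y = x := by rw [h, hr]
      rw [hy.2] at this
      subst this; exact hx.2 hy.2
  have h3 : (q '' {x ∈ S | r x = x}).ncard = {x ∈ S | r x = x}.ncard := by
    apply Set.ncard_image_of_injOn
    intro x hx y hy hxy
    rcases (hq _ _).1 hxy with h | h
    · exact h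
    · rw [h, hy.2]
  rw [h1, Set.ncard_union_eq h2 ((hS.subset (Set.sep_subset _ _)).image _)
    ((hS.subset (Set.sep_subset _ _)).image _), h3]
  omega

/-- A walk visits at most (number of non-loop edges) + 1 vertices. -/
lemma walk_count {V E : Type*} (v : ℕ → V) (e : ℕ → E)
    (h : ∀ i j, e i = e j → (v i = v j ∧ v (i+1) = v (j+1)) ∨ (v i = v (j+1) ∧ v (i+1) = v j))
    (hfin : {x | ∃ i, v i ≠ v (i+1) ∧ x = e i}.Finite) :
    (Set.range v).ncard ≤ {x | ∃ i, v i ≠ v (i+1) ∧ x = e i}.ncard + 1 := by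
  classical
  set E' := {x | ∃ i, v i ≠ v (i+1) ∧ x = e i}
  have key : ∀ x ∈ Set.range v \ {v 0}, ∃ i, v (i+1) = x ∧ ∀ j ≤ i, v j ≠ x := by
    rintro x ⟨hx, hx0⟩
    have hx' : ∃ i, v i = x := hx
    have hpos : Nat.find hx' ≠ 0 := by
      intro h0
      have := Nat.find_spec hx'
      rw [h0] at this
      exact hx0 this.symm
    refine ⟨Nat.find hx' - 1, ?_, ?_⟩
    · rw [Nat.sub_add_cancel (by omega)]; exact Nat.find_spec hx'
    · intro j hj
      exact Nat.find_min hx' (by omega)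
  choose! t ht ht' using key
  have h1 : (Set.range v \ {v 0}).ncard ≤ E'.ncard := by
    apply Set.ncard_le_ncard_of_injOn (fun x => e (t x)) _ _ hfin
    · intro x hx
      refine ⟨t x, ?_, rfl⟩
      rw [ht x hx]
      exact ht' x hx _ le_rfl
    · intro x hx y hy hxy
      by_contra hne
      have hx1 := ht x hx
      have hy1 := ht y hy
      rcases lt_trichotomy (t x) (t y) with hlt | heq | hlt
      · have a1 := ht' y hy (t x) (by omega)
        have a2 := ht' y hy (t x + 1) (by omega)
        rcases h _ _ hxy with ⟨b1, b2⟩ | ⟨b1, b2⟩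
        · exact a2 (b2.trans hy1)
        · exact a1 (b1.trans hy1)
      · rw [heq] at hx1; exact hne (hx1.symm.trans hy1)
      · have a1 := ht' x hx (t y) (by omega)
        have a2 := ht' x hx (t y + 1) (by omega)
        rcases h _ _ hxy with ⟨b1, b2⟩ | ⟨b1, b2⟩
        · exact a2 (b2.symm.trans hx1)
        · exact a1 (b2.symm.trans hx1)
  have h2 : (Set.range v).ncard ≤ (Set.range v \ {v 0}).ncard + 1 := by
    have := Set.ncard_insert_le (v 0) (Set.range v \ {v 0})
    rwa [Set.insert_diff_singleton, Set.insert_eq_of_mem (Set.mem_range_self 0)] at this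
  omega

lemma conn_count {V : Type*} [Finite V] (S : Set V) (E : Set (Sym2 V))
    (hc : ∀ c : V → Prop, (∀ x y, s(x, y) ∈ E → (c x ↔ c y)) →
      ∀ x ∈ S, ∀ y ∈ S, c x → c y) :
    S.ncard ≤ {z ∈ E | ¬ z.IsDiag}.ncard + 1 := by
  classical
  rcases S.eq_empty_or_nonempty with rfl | ⟨x0, hx0⟩
  · simp
  set G := SimpleGraph.fromEdgeSet E
  have hreach : ∀ x ∈ S, G.Reachable x0 x := by
    intro x hx
    refine hc (fun y => G.Reachable x0 y) ?_ x0 hx0 x hx (SimpleGraph.Reachable.refl _)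
    intro a b hab
    by_cases hne : a = b
    · rw [hne]
    · have hadj : G.Adj a b := by
        simp [G, SimpleGraph.fromEdgeSet_adj, hab, hne]
      exact ⟨fun h => h.trans hadj.reachable, fun h => h.trans hadj.symm.reachable⟩
  have key : ∀ x ∈ S \ {x0}, ∃ y, G.Adj x y ∧ G.dist y x0 < G.dist x x0 := by
    rintro x ⟨hx, hxne⟩
    obtain ⟨p, hp⟩ := (hreach x hx).symm.exists_walk_length_eq_dist
    cases p with
    | nil => exact absurd rfl hxne
    | cons h q =>
      refine ⟨_, h, ?_⟩
      have := SimpleGraph.dist_le q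
      simp only [SimpleGraph.Walk.length_cons] at hp
      omega
  choose! f hf hf' using key
  have h1 : (S \ {x0}).ncard ≤ {z ∈ E | ¬ z.IsDiag}.ncard := by
    apply Set.ncard_le_ncard_of_injOn (fun x => s(x, f x)) _ _ (Set.toFinite _)
    · intro x hx
      have := hf x hx
      simp only [G, SimpleGraph.fromEdgeSet_adj] at this
      exact ⟨this.1, by simpa using this.2⟩
    · intro x hx y hy hxy
      simp only [Sym2.eq_iff] at hxy
      rcases hxy with h | ⟨h, h'⟩
      · exact h.1
      · have a1 := hf' x hx
        have a2 := hf' y hy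
        rw [h'] at a1
        rw [← h] at a2
        omega
  have h2 : S.ncard ≤ (S \ {x0}).ncard + 1 := by
    have := Set.ncard_insert_le x0 (S \ {x0})
    rwa [Set.insert_diff_singleton, Set.insert_eq_of_mem hx0] at this
  omega

lemma ncard_fiber {T Q : Type*} (S : Set T) (hS : S.Finite) (B : Finset Q) (f : T → Q)
    (hf : ∀ x ∈ S, f x ∈ B) : S.ncard = ∑ b ∈ B, {x ∈ S | f x = b}.ncard := by
  classical
  obtain ⟨F, rfl⟩ : ∃ F : Finset T, S = ↑F := ⟨hS.toFinset, by simp⟩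
  rw [Set.ncard_coe_finset, Finset.card_eq_sum_card_fiberwise (f := f) (t := B) hf]
  refine Finset.sum_congr rfl fun b _ => ?_
  rw [← Set.ncard_coe_finset]
  congr 1
  ext; simp

section words
variable {A : Type*} {u : ℕ → A}

lemma word_length (i n : ℕ) : (word u i n).length = n := by simp [word]

lemma word_succ (i n : ℕ) : word u i (n+1) = word u i n ++ [u (i+n)] := by
  simp [word, List.range_succ]

lemma word_succ' (i n : ℕ) : word u i (n+1) = u i :: word u (i+1) n := by
  simp only [word, List.range_succ_eq_map, List.map_cons, List.map_map, Nat.add_zero]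
  congr 1
  apply List.map_congr_left
  intro a _
  simp only [Function.comp]
  congr 1; omega

lemma isFactor_word (i n : ℕ) : IsFactor u (word u i n) := ⟨i, by simp [OccursAt, word_length]⟩

lemma IsFactor.exists_word {w : List A} (h : IsFactor u w) : ∃ i, w = word u i w.length := h

lemma IsFactor.of_cons {a : A} {w : List A} (h : IsFactor u (a :: w)) : IsFactor u w := by
  obtain ⟨i, hi⟩ := h.exists_word
  rw [List.length_cons, word_succ'] at hi
  rw [(List.cons.inj hi).2]
  exact isFactor_word _ _

lemma IsFactor.of_snoc {b : A} {w : List A} (h : IsFactor u (w ++ [b])) : IsFactor u w := by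
  obtain ⟨i, hi⟩ := h.exists_word
  rw [List.length_append, List.length_singleton, word_succ] at hi
  rw [(List.append_inj' hi rfl).1]
  exact isFactor_word _ _

lemma IsFactor.exists_right {w : List A} (h : IsFactor u w) : ∃ b, IsFactor u (w ++ [b]) := by
  obtain ⟨i, hi⟩ := h.exists_word
  refine ⟨u (i + w.length), ?_⟩
  have := isFactor_word (u := u) i (w.length + 1)
  rwa [word_succ, ← hi] at this

lemma IsFactor.exists_left (hcur : ClosedUnderReversal u) {w : List A} (h : IsFactor u w) :
    ∃ b, IsFactor u (b :: w) := by
  obtain ⟨b, hb⟩ := (hcur _ h).exists_right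
  exact ⟨b, by simpa using hcur _ hb⟩

lemma finite_len [Finite A] (n : ℕ) (P : List A → Prop) : {w : List A | w.length = n ∧ P w}.Finite :=
  (List.finite_length_eq A n).subset fun _ h => h.1

lemma q_iff (x y : List A) : s(x, x.reverse) = s(y, y.reverse) ↔ x = y ∨ x = y.reverse := by
  rw [Sym2.eq_iff]
  constructor
  · rintro (h | h)
    · exact Or.inl h.1
    · exact Or.inr h.1
  · rintro (rfl | rfl)
    · simp
    · simp

lemma rauzy [Finite A] (hcur : ClosedUnderReversal u) {T : Type*} (n : ℕ) (α : List A → A → T)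
    (hα : ∀ a z b, z.length = n → IsFactor u (a :: (z ++ [b])) → α z b = α z.reverse a) :
    2 * {t | ∃ z b, z.length = n ∧ IsFactor u (z ++ [b]) ∧ t = α z b}.ncard
      + palComplexity u (n+1) ≤ complexity u (n+1) + 2 := by
  set v : ℕ → T := fun i => α (word u i n) (u (i+n)) with hv
  set e : ℕ → Sym2 (List A) := fun i => s(word u i (n+1), (word u i (n+1)).reverse) with he
  have hvs : ∀ i, v (i+1) = α (word u (i+1) n).reverse (u i) := by
    intro i
    apply hα _ _ _ (word_length _ _)
    have := isFactor_word (u := u) i (n+2)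
    rwa [word_succ', word_succ] at this
  have hrange : {t | ∃ z b, z.length = n ∧ IsFactor u (z ++ [b]) ∧ t = α z b} = Set.range v := by
    ext t
    constructor
    · rintro ⟨z, b, hz, hf, rfl⟩
      obtain ⟨i, hi⟩ := hf.exists_word
      rw [List.length_append, List.length_singleton, word_succ] at hi
      obtain ⟨h1, h2⟩ := List.append_inj' hi rfl
      refine ⟨i, ?_⟩
      simp only [List.cons.injEq, and_true] at h2
      rw [hz] at h1 h2
      simp only [hv]
      rw [← h1, ← h2]
    · rintro ⟨i, rfl⟩
      refine ⟨word u i n, u (i+n), word_length _ _, ?_, rfl⟩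
      rw [← word_succ]; exact isFactor_word _ _
  have hrev : ∀ i, (word u i (n+1)).reverse = (word u (i+1) n).reverse ++ [u i] := by
    intro i; rw [word_succ', List.reverse_cons]
  have hcross : ∀ i j, word u i (n+1) = (word u j (n+1)).reverse → v i = v (j+1) := by
    intro i j h
    rw [hrev, word_succ] at h
    obtain ⟨h1, h2⟩ := List.append_inj' h rfl
    simp only [List.cons.injEq, and_true] at h2
    rw [hvs]
    simp only [hv]
    rw [h1, h2]
  have hsub : {x | ∃ i, v i ≠ v (i+1) ∧ x = e i} ⊆ (fun x : List A => s(x, x.reverse)) ''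
      {x ∈ {w : List A | w.length = n+1 ∧ IsFactor u w} | x.reverse ≠ x} := by
    rintro _ ⟨i, hi, rfl⟩
    refine ⟨word u i (n+1), ⟨⟨word_length _ _, isFactor_word _ _⟩, ?_⟩, rfl⟩
    intro h
    exact hi (hcross i i h.symm)
  have hfin := ((finite_len (n+1) (fun w => IsFactor u w)).subset
    (Set.sep_subset _ (fun x => x.reverse ≠ x))).image (fun x : List A => s(x, x.reverse))
  have hw := walk_count v e (by
    intro i j hij
    rcases (q_iff _ _).1 hij with h | h
    · left
      constructor
      · rw [word_succ, word_succ] at h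
        obtain ⟨h1, h2⟩ := List.append_inj' h rfl
        simp only [List.cons.injEq, and_true] at h2
        simp only [hv]; rw [h1, h2]
      · rw [word_succ', word_succ'] at h
        obtain ⟨h1, h2⟩ := List.cons.inj h
        rw [hvs, hvs, h1, h2]
    · right
      refine ⟨hcross _ _ h, (hcross j i ?_).symm⟩
      rw [h, List.reverse_reverse]) (hfin.subset hsub)
  have hle := Set.ncard_le_ncard hsub hfin
  have hc := inv_count {w : List A | w.length = n+1 ∧ IsFactor u w} (finite_len _ _)
    List.reverse (fun x : List A => s(x, x.reverse)) List.reverse_reverse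
    (fun x hx => ⟨by simpa using hx.1, hcur _ hx.2⟩) q_iff
  have hp : palComplexity u (n+1) =
      {x ∈ {w : List A | w.length = n+1 ∧ IsFactor u w} | x.reverse = x}.ncard := by
    unfold palComplexity; congr 1; ext x; simp [and_assoc]
  rw [hrange, hp, complexity]
  omega

lemma vert_count [Finite A] (hcur : ClosedUnderReversal u) (n : ℕ) :
    2 * ((fun x : List A => s(x, x.reverse)) '' {w : List A | w.length = n ∧ IsFactor u w}).ncard
      = complexity u n + palComplexity u n := by
  have hc := inv_count' {w : List A | w.length = n ∧ IsFactor u w} (finite_len _ _)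
    List.reverse (fun x : List A => s(x, x.reverse)) List.reverse_reverse
    (fun x hx => ⟨by simpa using hx.1, hcur _ hx.2⟩) q_iff
  have hp : palComplexity u n =
      {x ∈ {w : List A | w.length = n ∧ IsFactor u w} | x.reverse = x}.ncard := by
    unfold palComplexity; congr 1; ext x; simp [and_assoc]
  rw [hc, hp, complexity]

lemma pal_bound [Finite A] (hcur : ClosedUnderReversal u) (n : ℕ) :
    complexity u n + palComplexity u n + palComplexity u (n+1) ≤ complexity u (n+1) + 2 := by
  have h := rauzy hcur n (fun z _ => s(z, z.reverse)) (by intros; simp [Sym2.eq_swap])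
  have h2 := vert_count hcur n
  have h3 : {t | ∃ z b, z.length = n ∧ IsFactor u (z ++ [b]) ∧ t = s(z, z.reverse)} =
      ((fun x : List A => s(x, x.reverse)) '' {w : List A | w.length = n ∧ IsFactor u w}) := by
    ext t
    constructor
    · rintro ⟨z, b, hz, hf, rfl⟩
      exact ⟨z, ⟨hz, hf.of_snoc⟩, rfl⟩
    · rintro ⟨z, ⟨hz, hf⟩, rfl⟩
      obtain ⟨b, hb⟩ := hf.exists_right
      exact ⟨z, b, hz, hb, rfl⟩
  rw [h3] at h
  omega

open Classical in
/-- In the equality case, extension graphs cannot be cut. -/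
lemma cut [Finite A] (hcur : ClosedUnderReversal u) (w : List A)
    (heq : complexity u w.length + palComplexity u w.length + palComplexity u (w.length+1)
      = complexity u (w.length+1) + 2)
    (hw : IsFactor u w)
    (cL cR : A → Prop) (hpal : w.reverse = w → cL = cR)
    (hB : ∀ a b, IsFactor u (a :: (w ++ [b])) → (cL a ↔ cR b))
    (z1 : List A) (b1 : A) (z2 : List A) (b2 : A)
    (hz1 : z1 = w ∧ cR b1 ∨ z1 = w.reverse ∧ cL b1)
    (hz2 : z2 = w ∧ ¬ cR b2 ∨ z2 = w.reverse ∧ ¬ cL b2)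
    (hf1 : IsFactor u (z1 ++ [b1])) (hf2 : IsFactor u (z2 ++ [b2])) : False := by
  set n := w.length with hn
  set col : List A → A → Prop := fun z b =>
    if z = w then cR b else if z = w.reverse then cL b else False with hcol
  have colw : ∀ b, col w b = cR b := by intro b; simp [hcol]
  have colr : ∀ b, col w.reverse b = cL b := by
    intro b
    by_cases h : w.reverse = w
    · simp [hcol, h, hpal h]
    · simp [hcol, h]
  have colo : ∀ z b, z ≠ w → z ≠ w.reverse → col z b = False := by
    intro z b h1 h2; simp [hcol, h1, h2]
  have h := rauzy hcur n (fun z b => (s(z, z.reverse), col z b)) (by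
    intro a z b hz hf
    refine Prod.ext (by simp [Sym2.eq_swap]) ?_
    simp only
    by_cases h1 : z = w
    · subst h1
      rw [colw, colr]; exact propext (hB _ _ hf).symm
    · by_cases h2 : z = w.reverse
      · subst h2
        rw [colr, List.reverse_reverse, colw]
        refine propext (hB _ _ ?_)
        simpa using hcur _ hf
      · rw [colo _ _ h1 h2, colo]
        · intro h; exact h2 (by rw [← h, List.reverse_reverse])
        · intro h; exact h1 (List.reverse_injective h))
  have h2 := vert_count hcur n
  set F := {w : List A | w.length = n ∧ IsFactor u w}
  set Q := (fun x : List A => s(x, x.reverse)) '' F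
  have hQfin : Q.Finite := (finite_len n _).image _
  have hq1 : s(z1, z1.reverse) = s(w, w.reverse) := by
    rw [q_iff]; rcases hz1 with h | h
    · exact Or.inl h.1
    · exact Or.inr h.1
  have hq2 : s(z2, z2.reverse) = s(w, w.reverse) := by
    rw [q_iff]; rcases hz2 with h | h
    · exact Or.inl h.1
    · exact Or.inr h.1
  have hc1 : col z1 b1 = True := by
    rcases hz1 with ⟨hz, hh⟩ | ⟨hz, hh⟩
    · rw [hz, colw]; exact eq_true hh
    · rw [hz, colr]; exact eq_true hh
  have hc2 : col z2 b2 = False := by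
    rcases hz2 with ⟨hz, hh⟩ | ⟨hz, hh⟩
    · rw [hz, colw]; exact eq_false hh
    · rw [hz, colr]; exact eq_false hh
  have hl1 : z1.length = n := by rcases hz1 with ⟨hz, _⟩ | ⟨hz, _⟩ <;> simp [hz, hn]
  have hl2 : z2.length = n := by rcases hz2 with ⟨hz, _⟩ | ⟨hz, _⟩ <;> simp [hz, hn]
  set R := {t | ∃ z b, z.length = n ∧ IsFactor u (z ++ [b]) ∧ t = (s(z, z.reverse), col z b)}
    with hR
  have hRfin : R.Finite := by
    refine (hQfin.prod (Set.toFinite (Set.univ : Set Prop))).subset ?_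
    rintro _ ⟨z, b, hz, hf, rfl⟩
    exact ⟨⟨z, ⟨hz, hf.of_snoc⟩, rfl⟩, trivial⟩
  have hsub : insert (s(w, w.reverse), True) ((fun t => (t, False)) '' Q) ⊆ R := by
    rintro t (rfl | ⟨_, ⟨z, ⟨hz, hf⟩, rfl⟩, rfl⟩)
    · exact ⟨z1, b1, hl1, hf1, by rw [hq1, hc1]⟩
    · by_cases hzw : s(z, z.reverse) = s(w, w.reverse)
      · exact ⟨z2, b2, hl2, hf2, by simp only [hq2, hc2, hzw]⟩
      · obtain ⟨b, hb⟩ := hf.exists_right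
        refine ⟨z, b, hz, hb, ?_⟩
        rw [q_iff] at hzw
        push Not at hzw
        rw [colo _ _ hzw.1 hzw.2]
  have h3 := Set.ncard_le_ncard hsub hRfin
  rw [Set.ncard_insert_of_notMem (by rintro ⟨_, _, h⟩; simpa using (Prod.ext_iff.1 h).2)
    (hQfin.image _), Set.ncard_image_of_injective _ (by intro a b h; exact (Prod.ext_iff.1 h).1)] at h3
  omega

lemma ext_symm (hcur : ClosedUnderReversal u) {w : List A} (hp : w.reverse = w) :
    Lext u w = Rext u w := by
  ext a
  constructor
  · intro h
    have := hcur _ h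
    rw [List.reverse_cons, hp] at this; exact this
  · intro h
    have := hcur _ h
    rw [List.reverse_append, hp] at this; exact this

lemma bext_swap (hcur : ClosedUnderReversal u) {w : List A} (hp : w.reverse = w) {a b : A}
    (h : (a, b) ∈ Bext u w) : (b, a) ∈ Bext u w := by
  have := hcur _ h
  simpa [Bext, hp] using this

lemma pext_ncard (w : List A) :
    (Pext u w).ncard = {x ∈ Bext u w | x.swap = x}.ncard := by
  have h : Pext u w = (fun p : A × A => p.1 :: (w ++ [p.2])) '' {x ∈ Bext u w | x.swap = x} := by
    ext v
    constructor
    · rintro ⟨a, rfl, hf⟩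
      exact ⟨(a, a), ⟨hf, rfl⟩, rfl⟩
    · rintro ⟨⟨a, b⟩, ⟨hf, hs⟩, rfl⟩
      obtain rfl : b = a := (Prod.ext_iff.1 hs).1
      exact ⟨b, rfl, hf⟩
  rw [h, Set.ncard_image_of_injective]
  rintro ⟨a, b⟩ ⟨c, d⟩ h
  simp only [List.cons.injEq, List.append_cancel_left_eq, and_true] at h
  exact Prod.ext h.1 h.2

lemma bext_count [Finite A] (hcur : ClosedUnderReversal u) {w : List A} (hp : w.reverse = w) :
    2 * ((fun p : A × A => s(p.1, p.2)) '' {x ∈ Bext u w | x.swap ≠ x}).ncard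
      + (Pext u w).ncard = (Bext u w).ncard := by
  rw [pext_ncard]
  apply inv_count _ (Set.toFinite _) Prod.swap _ Prod.swap_swap
  · rintro ⟨a, b⟩ h; exact bext_swap hcur hp h
  · rintro ⟨a, b⟩ ⟨c, d⟩
    simp [Sym2.eq_iff, Prod.ext_iff]

lemma order_nonneg [Finite A] (hcur : ClosedUnderReversal u) (w : List A)
    (heq : complexity u w.length + palComplexity u w.length + palComplexity u (w.length+1)
      = complexity u (w.length+1) + 2)
    (hw : IsFactor u w) (hPE : w.reverse = w → (Pext u w).ncard = 1) :
    0 ≤ bilateralOrder u w := by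
  unfold bilateralOrder
  have hLr : ∀ a ∈ Lext u w, IsFactor u (w.reverse ++ [a]) := by
    intro a ha; simpa using hcur _ ha
  by_cases hp : w.reverse = w
  · have h1 := bext_count hcur hp
    have h2 := hPE hp
    have h3 := conn_count (Rext u w) ((fun p : A × A => s(p.1, p.2)) '' (Bext u w)) (by
      intro c hc x hx y hy hcx
      by_contra hcy
      refine cut hcur w heq hw c c (fun _ => rfl) ?_ w x w y (Or.inl ⟨rfl, hcx⟩)
        (Or.inl ⟨rfl, hcy⟩) hx hy
      intro a b hab
      exact hc a b ⟨(a, b), hab, rfl⟩)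
    have h4 : {z ∈ ((fun p : A × A => s(p.1, p.2)) '' (Bext u w)) | ¬ z.IsDiag} ⊆
        ((fun p : A × A => s(p.1, p.2)) '' {x ∈ Bext u w | x.swap ≠ x}) := by
      rintro _ ⟨⟨⟨a, b⟩, hab, rfl⟩, hd⟩
      refine ⟨(a, b), ⟨hab, ?_⟩, rfl⟩
      intro h
      exact hd (Prod.ext_iff.1 h).2
    have h5 := Set.ncard_le_ncard h4 (Set.toFinite _)
    rw [ext_symm hcur hp]
    omega
  · have h3 := conn_count (Sum.inl '' Lext u w ∪ Sum.inr '' Rext u w : Set (A ⊕ A))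
      ((fun p : A × A => s(Sum.inl p.1, Sum.inr p.2)) '' (Bext u w)) (by
      intro c hc x hx y hy hcx
      by_contra hcy
      have hcut := cut hcur w heq hw (fun a => c (Sum.inl a)) (fun a => c (Sum.inr a))
        (fun h => absurd h hp) (fun a b hab => hc _ _ ⟨(a, b), hab, rfl⟩)
      rcases hx with ⟨x, hx, rfl⟩ | ⟨x, hx, rfl⟩ <;> rcases hy with ⟨y, hy, rfl⟩ | ⟨y, hy, rfl⟩
      · exact hcut _ x _ y (Or.inr ⟨rfl, hcx⟩) (Or.inr ⟨rfl, hcy⟩) (hLr _ hx) (hLr _ hy)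
      · exact hcut _ x _ y (Or.inr ⟨rfl, hcx⟩) (Or.inl ⟨rfl, hcy⟩) (hLr _ hx) hy
      · exact hcut _ x _ y (Or.inl ⟨rfl, hcx⟩) (Or.inr ⟨rfl, hcy⟩) hx (hLr _ hy)
      · exact hcut _ x _ y (Or.inl ⟨rfl, hcx⟩) (Or.inl ⟨rfl, hcy⟩) hx hy)
    have h4 := Set.ncard_le_ncard (Set.sep_subset
      ((fun p : A × A => s((Sum.inl p.1 : A ⊕ A), Sum.inr p.2)) '' (Bext u w))
      (fun z => ¬ z.IsDiag)) (Set.toFinite _)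
    have h5 := Set.ncard_image_le (f := fun p : A × A => s((Sum.inl p.1 : A ⊕ A), Sum.inr p.2))
      (Set.toFinite (Bext u w))
    rw [Set.ncard_union_eq (by
        rw [Set.disjoint_left]; rintro _ ⟨x, _, rfl⟩ ⟨y, _, h⟩; cases h)
      (Set.toFinite _) (Set.toFinite _), Set.ncard_image_of_injective _ Sum.inl_injective,
      Set.ncard_image_of_injective _ Sum.inr_injective] at h3
    have h6 : {z ∈ ((fun p : A × A => s((Sum.inl p.1 : A ⊕ A), Sum.inr p.2)) '' (Bext u w)) |
      ¬ z.IsDiag}.ncard ≤ (Bext u w).ncard := h4.trans h5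
    omega

noncomputable def facs [Finite A] (u : ℕ → A) (n : ℕ) : Finset (List A) :=
  (finite_len n (fun w => IsFactor u w)).toFinset

noncomputable def pals [Finite A] (u : ℕ → A) (n : ℕ) : Finset (List A) :=
  (finite_len n (fun w => IsFactor u w ∧ w.reverse = w)).toFinset

lemma mem_facs [Finite A] {n : ℕ} {w : List A} :
    w ∈ facs u n ↔ w.length = n ∧ IsFactor u w := by simp [facs]

lemma mem_pals [Finite A] {n : ℕ} {w : List A} :
    w ∈ pals u n ↔ w.length = n ∧ IsFactor u w ∧ w.reverse = w := by simp [pals]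

lemma facs_card [Finite A] (n : ℕ) : (facs u n).card = complexity u n := by
  rw [← Set.ncard_coe_finset, complexity]; congr 1; ext; simp [mem_facs]

lemma pals_card [Finite A] (n : ℕ) : (pals u n).card = palComplexity u n := by
  rw [← Set.ncard_coe_finset, palComplexity]; congr 1; ext; simp [mem_pals]

lemma sum_R [Finite A] (n : ℕ) : complexity u (n+1) = ∑ w ∈ facs u n, (Rext u w).ncard := by
  rw [complexity, ncard_fiber _ (finite_len _ _) (facs u n) List.dropLast]
  · refine Finset.sum_congr rfl fun w hw => ?_
    rw [mem_facs] at hw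
    rw [← Set.ncard_image_of_injective (Rext u w) (f := fun b => w ++ [b])
      (by intro a b h; simpa using h)]
    congr 1
    ext x
    constructor
    · rintro ⟨⟨hx, hf⟩, rfl⟩
      have hne : x ≠ [] := by rintro rfl; simp at hx
      refine ⟨x.getLast hne, ?_, List.dropLast_append_getLast hne⟩
      change IsFactor u _
      rwa [List.dropLast_append_getLast hne]
    · rintro ⟨b, hb, rfl⟩
      exact ⟨⟨by simp [hw.1], hb⟩, by simp⟩
  · rintro x ⟨hx, hf⟩
    have hne : x ≠ [] := by rintro rfl; simp at hx
    rw [mem_facs]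
    refine ⟨by simp [hx], ?_⟩
    rw [← List.dropLast_append_getLast hne] at hf
    exact hf.of_snoc

lemma sum_L [Finite A] (n : ℕ) : complexity u (n+1) = ∑ w ∈ facs u n, (Lext u w).ncard := by
  rw [complexity, ncard_fiber _ (finite_len _ _) (facs u n) List.tail]
  · refine Finset.sum_congr rfl fun w hw => ?_
    rw [mem_facs] at hw
    rw [← Set.ncard_image_of_injective (Lext u w) (f := fun b => b :: w)
      (by intro a b h; simpa using h)]
    congr 1
    ext x
    constructor
    · rintro ⟨⟨hx, hf⟩, rfl⟩
      cases x with
      | nil => simp at hx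
      | cons a x => exact ⟨a, hf, rfl⟩
    · rintro ⟨b, hb, rfl⟩
      exact ⟨⟨by simp [hw.1], hb⟩, by simp⟩
  · rintro x ⟨hx, hf⟩
    rw [mem_facs]
    cases x with
    | nil => simp at hx
    | cons a x => exact ⟨by simpa using hx, hf.of_cons⟩

lemma split2 {n : ℕ} {x : List A} (hx : x.length = n + 2) :
    ∃ a z b, x = a :: (z ++ [b]) ∧ z.length = n := by
  cases x with
  | nil => simp at hx
  | cons a x =>
    have hne : x ≠ [] := by rintro rfl; simp at hx
    refine ⟨a, x.dropLast, x.getLast hne, by rw [List.dropLast_append_getLast hne], ?_⟩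
    simp at hx ⊢; omega

lemma sum_B [Finite A] (n : ℕ) : complexity u (n+2) = ∑ w ∈ facs u n, (Bext u w).ncard := by
  rw [complexity, ncard_fiber _ (finite_len _ _) (facs u n) (fun x => x.tail.dropLast)]
  · refine Finset.sum_congr rfl fun w hw => ?_
    rw [mem_facs] at hw
    rw [← Set.ncard_image_of_injective (Bext u w) (f := fun p => p.1 :: (w ++ [p.2]))
      (by rintro ⟨a, b⟩ ⟨c, d⟩ h; simpa using h)]
    congr 1
    ext x
    constructor
    · rintro ⟨⟨hx, hf⟩, rfl⟩
      obtain ⟨a, z, b, rfl, hz⟩ := split2 hx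
      exact ⟨(a, b), by simpa [Bext] using hf, by simp⟩
    · rintro ⟨b, hb, rfl⟩
      exact ⟨⟨by simp [hw.1], hb⟩, by simp⟩
  · rintro x ⟨hx, hf⟩
    obtain ⟨a, z, b, rfl, hz⟩ := split2 hx
    rw [mem_facs]
    exact ⟨by simpa using hz, by simpa using hf.of_cons.of_snoc⟩

lemma pal_split {a b : A} {z : List A} (h : (a :: (z ++ [b])).reverse = a :: (z ++ [b])) :
    b = a ∧ z.reverse = z := by
  simp only [List.reverse_cons, List.reverse_append, List.reverse_nil, List.nil_append,
    List.cons_append, List.cons.injEq] at h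
  obtain ⟨rfl, h⟩ := h
  exact ⟨rfl, (List.append_inj' h rfl).1⟩

lemma sum_P [Finite A] (n : ℕ) : palComplexity u (n+2) = ∑ w ∈ pals u n, (Pext u w).ncard := by
  rw [palComplexity, ncard_fiber _ (finite_len _ _) (pals u n) (fun x => x.tail.dropLast)]
  · refine Finset.sum_congr rfl fun w hw => ?_
    rw [mem_pals] at hw
    congr 1
    ext x
    constructor
    · rintro ⟨⟨hx, hf, hp⟩, rfl⟩
      obtain ⟨a, z, b, rfl, hz⟩ := split2 hx
      obtain ⟨rfl, h⟩ := pal_split hp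
      exact ⟨b, by simp, hf⟩
    · rintro ⟨b, rfl, hb⟩
      exact ⟨⟨by simp [hw.1], hb, by simp [hw.2.2]⟩, by simp⟩
  · rintro x ⟨hx, hf, hp⟩
    obtain ⟨a, z, b, rfl, hz⟩ := split2 hx
    obtain ⟨rfl, h⟩ := pal_split hp
    rw [mem_pals]
    exact ⟨by simpa using hz, by simpa using hf.of_cons.of_snoc, by simpa using h⟩

lemma pal_zero : palComplexity u 0 = 1 := by
  have : {w : List A | w.length = 0 ∧ IsFactor u w ∧ w.reverse = w} = {[]} := by
    ext w
    constructor
    · rintro ⟨h, _⟩; simpa using h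
    · rintro rfl
      exact ⟨rfl, ⟨0, by simp [OccursAt, word]⟩, rfl⟩
  rw [palComplexity, this, Set.ncard_singleton]

lemma pal_one [Fintype A] (hall : AllLettersOccur u) : palComplexity u 1 = Fintype.card A := by
  have : {w : List A | w.length = 1 ∧ IsFactor u w ∧ w.reverse = w} =
      (fun a : A => [a]) '' Set.univ := by
    ext w
    constructor
    · rintro ⟨h, _⟩
      obtain ⟨a, rfl⟩ := List.length_eq_one_iff.1 h
      exact ⟨a, trivial, rfl⟩
    · rintro ⟨a, _, rfl⟩
      obtain ⟨i, rfl⟩ := hall a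
      exact ⟨rfl, ⟨i, by simp [OccursAt, word]⟩, rfl⟩
  rw [palComplexity, this, Set.ncard_image_of_injective _ (by intro a b h; simpa using h),
    Set.ncard_univ, Nat.card_eq_fintype_card]

lemma pext_pos [Finite A] (hcur : ClosedUnderReversal u)
    (hBO : ∀ w : List A, Bispecial u w → bilateralOrder u w = 0)
    {w : List A} (hw : IsFactor u w) (hp : w.reverse = w) : 1 ≤ (Pext u w).ncard := by
  by_cases hb : 2 ≤ (Rext u w).ncard
  · have h1 := hBO w ⟨hw, by rwa [ext_symm hcur hp], hb⟩
    unfold bilateralOrder at h1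
    rw [ext_symm hcur hp] at h1
    have h2 := bext_count hcur hp
    omega
  · obtain ⟨b, hwb⟩ := hw.exists_right
    obtain ⟨a, hawb⟩ := hwb.exists_left hcur
    have hab : a = b := by
      have ha : a ∈ Rext u w := by
        rw [← ext_symm hcur hp]
        exact IsFactor.of_snoc (b := b) hawb
      exact (Set.ncard_le_one (Set.toFinite _)).1 (by omega) a ha b hwb
    subst hab
    rw [pext_ncard]
    exact (Set.ncard_pos (Set.toFinite _)).2 ⟨(a, a), hawb, rfl⟩

end words

theorem stmt16 {A : Type*} [Fintype A] (u : ℕ → A)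
    (hall : AllLettersOccur u)
    (hcur : ClosedUnderReversal u)
    (hC : ∀ n : ℕ, complexity u n = (Fintype.card A - 1) * n + 1) :
    (∀ w : List A, IsFactor u w → w.reverse = w →
        Set.ncard (Pext u w) = 1) ↔
      (∀ w : List A, Bispecial u w → bilateralOrder u w = 0) := by
  have hk : 1 ≤ Fintype.card A := Fintype.card_pos_iff.2 ⟨u 0⟩
  have hCs : ∀ n, complexity u (n+1) + 1 = complexity u n + Fintype.card A := by
    intro n
    rw [hC, hC, mul_add, mul_one]
    omega
  constructor
  · intro hPE
    have hP2 : ∀ n, palComplexity u (n+2) = palComplexity u n := by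
      intro n
      rw [sum_P, ← pals_card, Finset.card_eq_sum_ones]
      refine Finset.sum_congr rfl fun w hw => ?_
      rw [mem_pals] at hw
      exact hPE w hw.2.1 hw.2.2
    have hPP : ∀ n, palComplexity u n + palComplexity u (n+1) = Fintype.card A + 1 := by
      intro n
      induction n with
      | zero => rw [pal_zero, pal_one hall]; omega
      | succ n ih => rw [hP2]; omega
    have hnn : ∀ w, IsFactor u w → 0 ≤ bilateralOrder u w := by
      intro w hw
      refine order_nonneg hcur w ?_ hw (hPE w hw)
      have := hPP w.length
      have := hCs w.length
      omega
    intro w hw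
    have hsum : ∑ v ∈ facs u w.length, bilateralOrder u v = 0 := by
      simp only [bilateralOrder, Finset.sum_add_distrib, Finset.sum_sub_distrib]
      have h1 := sum_B (u := u) w.length
      have h2 := sum_R (u := u) w.length
      have h3 := sum_L (u := u) w.length
      have h4 := facs_card (u := u) w.length
      have h5 := hCs w.length
      have h6 : complexity u (w.length + 2) + 1 = _ := hCs (w.length + 1)
      rw [← Nat.cast_sum, ← Nat.cast_sum, ← Nat.cast_sum, ← h1, ← h2, ← h3, Finset.sum_const, h4,
        nsmul_eq_mul, mul_one]
      omega
    exact (Finset.sum_eq_zero_iff_of_nonneg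
      (fun v hv => hnn v (mem_facs.1 hv).2)).1 hsum w (mem_facs.2 ⟨rfl, hw.1⟩)
  · intro hBO w hw hp
    have hpos : ∀ n, ∀ v ∈ pals u n, 1 ≤ (Pext u v).ncard := fun n v hv =>
      pext_pos hcur hBO (mem_pals.1 hv).2.1 (mem_pals.1 hv).2.2
    have hmono : ∀ n, palComplexity u n ≤ palComplexity u (n+2) := by
      intro n
      rw [sum_P, ← pals_card, Finset.card_eq_sum_ones]
      exact Finset.sum_le_sum (hpos n)
    have hge : ∀ n, Fintype.card A + 1 ≤ palComplexity u n + palComplexity u (n+1) := by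
      intro n
      induction n with
      | zero => rw [pal_zero, pal_one hall]; omega
      | succ n ih =>
        have := hmono n
        change _ ≤ _ + palComplexity u (n + 2)
        omega
    have hle : ∀ n, palComplexity u n + palComplexity u (n+1) ≤ Fintype.card A + 1 := by
      intro n
      have := pal_bound hcur n
      have := hCs n
      omega
    have heq : palComplexity u (w.length + 2) = palComplexity u w.length := by
      have := hge w.length
      have := hle w.length
      have : _ ≤ _ + palComplexity u (w.length + 2) := hge (w.length + 1)
      have : _ + palComplexity u (w.length + 2) ≤ _ := hle (w.length + 1)
      omega
    rw [sum_P, ← pals_card, Finset.card_eq_sum_ones] at heq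
    exact ((Finset.sum_eq_sum_iff_of_le (hpos w.length)).1 heq.symm w
      (mem_pals.2 ⟨rfl, hw, hp⟩)).symm
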